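/- Let Λ ⊆ ℝ^N be a non-periodic Delone set. Then the following are equivalent: (i) Λ is linearly repetitive (LR); (ii) Λ satisfies positivity of quasiweights (PQ) and uniformity of return words (U); (iii) Λ satisfies positivity of weights (PW) and uniformity of return words (U). -/

import Mathlib

open Filter MeasureTheory Bornology
open scoped ENNReal

noncomputable section

/-- Euclidean space `ℝ^N`. -/
abbrev Euc (N : ℕ) := EuclideanSpace ℝ (Fin N)

/-- The packing radius of a set: half of the infimum of distances between
distinct points (`⊤` if no such pair exists). -/
def rPack {N : ℕ} (Λ : Set (Euc N)) : ℝ≥0∞ :=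
  ⨅ (x ∈ Λ) (y ∈ Λ) (_ : x ≠ y), edist x y / 2

/-- The covering radius of a set: the supremum over all points of the space of
the distance to the set. -/
def rCov {N : ℕ} (Λ : Set (Euc N)) : ℝ≥0∞ :=
  ⨆ p : Euc N, EMetric.infEdist p Λ

/-- A set is uniformly discrete if its packing radius is positive. -/
def UniformlyDiscrete {N : ℕ} (Λ : Set (Euc N)) : Prop := 0 < rPack Λ

/-- A set is relatively dense if its covering radius is finite. -/
def RelativelyDense {N : ℕ} (Λ : Set (Euc N)) : Prop := rCov Λ < ⊤

/-- A Delone set is a uniformly discrete and relatively dense set. -/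
def IsDelone {N : ℕ} (Λ : Set (Euc N)) : Prop :=
  UniformlyDiscrete Λ ∧ RelativelyDense Λ

/-- Λ is non-periodic if no nonzero translate of Λ equals Λ. -/
def NonPeriodic {N : ℕ} (Λ : Set (Euc N)) : Prop :=
  ∀ t : Euc N, t ≠ 0 → (fun p => p - t) '' Λ ≠ Λ

/-- The patch of the ball pattern `(x, R)`: `(Λ - x) ∩ B_R`. -/
def patch {N : ℕ} (Λ : Set (Euc N)) (x : Euc N) (R : ℝ) : Set (Euc N) :=
  ((fun y => y - x) '' Λ) ∩ Metric.closedBall 0 R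

/-- The locater set of the ball pattern `(x, R)`: the set of points of Λ whose
`R`-patch agrees with that of `x`. -/
def locSet {N : ℕ} (Λ : Set (Euc N)) (x : Euc N) (R : ℝ) : Set (Euc N) :=
  {y ∈ Λ | patch Λ y R = patch Λ x R}

/-- Λ is repetitive if the locater set of every ball pattern is relatively dense. -/
def Repetitive {N : ℕ} (Λ : Set (Euc N)) : Prop :=
  ∀ x ∈ Λ, ∀ R : ℝ, 0 < R → RelativelyDense (locSet Λ x R)

/-- `L_P(Q)`: the points of the locater set of `(x,R)` whose `R`-ball lies inside `Q`. -/
def locIn {N : ℕ} (Λ : Set (Euc N)) (x : Euc N) (R : ℝ) (Q : Set (Euc N)) :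
    Set (Euc N) :=
  {y ∈ locSet Λ x R | Metric.closedBall y R ⊆ Q}

/-- `♯_P Q`: the number of copies of the ball pattern `P = (x,R)` in `Q`. -/
def countP {N : ℕ} (Λ : Set (Euc N)) (x : Euc N) (R : ℝ) (Q : Set (Euc N)) : ℕ :=
  (locIn Λ x R Q).ncard

/-- `♯'_P Q`: the maximal number of completely disjoint copies of `P = (x,R)` in `Q`. -/
def countP' {N : ℕ} (Λ : Set (Euc N)) (x : Euc N) (R : ℝ) (Q : Set (Euc N)) : ℕ :=
  sSup {n : ℕ | ∃ A : Finset (Euc N), ↑A ⊆ locIn Λ x R Q ∧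
    (∀ u ∈ A, ∀ v ∈ A, u ≠ v → 2 * R < dist u v) ∧ A.card = n}

/-- The cube with corner `a` and sidelength `s`. -/
def cube {N : ℕ} (a : Euc N) (s : ℝ) : Set (Euc N) :=
  {p | ∀ i, a i ≤ p i ∧ p i ≤ a i + s}

/-- The filter describing cubes `C` with `|C| → ∞`: arbitrary corner, sidelength
tending to infinity. -/
def cubeFilter (N : ℕ) : Filter (Euc N × ℝ) := (⊤ : Filter (Euc N)) ×ˢ atTop

/-- The Lebesgue measure `|B_R|` of a closed ball of radius `R` in `ℝ^N`. -/
def ballVol (N : ℕ) (R : ℝ) : ℝ := (volume (Metric.closedBall (0 : Euc N) R)).toReal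

/-- The lower density `ν(P)` of the ball pattern `P = (x,R)`:
`liminf_{|C|→∞} ♯_P C · |B_R| / |C|` over cubes `C`. -/
def nu {N : ℕ} (Λ : Set (Euc N)) (x : Euc N) (R : ℝ) : ℝ :=
  liminf (fun cs : Euc N × ℝ =>
    (countP Λ x R (cube cs.1 cs.2) : ℝ) * ballVol N R / cs.2 ^ N) (cubeFilter N)

/-- The lower reduced density `ν'(P)` of the ball pattern `P = (x,R)`:
`liminf_{|C|→∞} ♯'_P C · |B_R| / |C|` over cubes `C`. -/
def nu' {N : ℕ} (Λ : Set (Euc N)) (x : Euc N) (R : ℝ) : ℝ :=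
  liminf (fun cs : Euc N × ℝ =>
    (countP' Λ x R (cube cs.1 cs.2) : ℝ) * ballVol N R / cs.2 ^ N) (cubeFilter N)

/-- `w = inf {ν(P) : r(P) ≥ 1}`. -/
def wPW {N : ℕ} (Λ : Set (Euc N)) : ℝ :=
  sInf {v | ∃ x ∈ Λ, ∃ R : ℝ, 1 ≤ R ∧ v = nu Λ x R}

/-- `w' = inf {ν'(P) : r(P) ≥ 1}`. -/
def wPQ {N : ℕ} (Λ : Set (Euc N)) : ℝ :=
  sInf {v | ∃ x ∈ Λ, ∃ R : ℝ, 1 ≤ R ∧ v = nu' Λ x R}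

/-- Positivity of weights (PW). -/
def PW {N : ℕ} (Λ : Set (Euc N)) : Prop := 0 < wPW Λ

/-- Positivity of quasiweights (PQ). -/
def PQ {N : ℕ} (Λ : Set (Euc N)) : Prop := 0 < wPQ Λ

/-- A function on (bounded) subsets of `ℝ^N` is subadditive if
`F(Q₁ ∪ Q₂) ≤ F(Q₁) + F(Q₂)` for disjoint bounded `Q₁, Q₂`. -/
def SubadditiveFn {N : ℕ} (F : Set (Euc N) → ℝ) : Prop :=
  ∀ Q₁ Q₂ : Set (Euc N), IsBounded Q₁ → IsBounded Q₂ → Disjoint Q₁ Q₂ →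
    F (Q₁ ∪ Q₂) ≤ F Q₁ + F Q₂

/-- A function on (bounded) subsets is Λ-invariant if `F(Q) = F(t + Q)` whenever
`t + (Q ∩ Λ) = (t + Q) ∩ Λ`. -/
def InvariantFn {N : ℕ} (Λ : Set (Euc N)) (F : Set (Euc N) → ℝ) : Prop :=
  ∀ (t : Euc N) (Q : Set (Euc N)), IsBounded Q →
    (fun p => t + p) '' (Q ∩ Λ) = ((fun p => t + p) '' Q) ∩ Λ →
    F Q = F ((fun p => t + p) '' Q)

/-- Λ satisfies the subadditive ergodic theorem (SET) if for every subadditive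
Λ-invariant function `F` the limit `lim_{|C|→∞} F(C)/|C|` over cubes exists. -/
def SET {N : ℕ} (Λ : Set (Euc N)) : Prop :=
  ∀ F : Set (Euc N) → ℝ, SubadditiveFn F → InvariantFn Λ F →
    ∃ L : ℝ, Tendsto (fun cs : Euc N × ℝ => F (cube cs.1 cs.2) / cs.2 ^ N)
      (cubeFilter N) (nhds L)

/-- Linear repetitivity (LR): `sup {r_cov(L_P)/r(P) : r(P) ≥ 1} < ∞`. -/
def LR {N : ℕ} (Λ : Set (Euc N)) : Prop :=
  (⨆ (x ∈ Λ) (R : ℝ) (_ : 1 ≤ R), rCov (locSet Λ x R) / ENNReal.ofReal R) < ⊤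

/-- The repulsion property (RP): `inf {r_pack(L_P)/r(P) : P a ball pattern} > 0`. -/
def RP {N : ℕ} (Λ : Set (Euc N)) : Prop :=
  0 < ⨅ (x ∈ Λ) (R : ℝ) (_ : 0 < R), rPack (locSet Λ x R) / ENNReal.ofReal R

/-- The Voronoi cell of `x` with respect to `Γ`. -/
def voronoiCell {N : ℕ} (Γ : Set (Euc N)) (x : Euc N) : Set (Euc N) :=
  {p | ∀ y ∈ Γ, dist p x ≤ dist p y}

/-- The inner radius of a set `V` around `x`. -/
def rIn {N : ℕ} (x : Euc N) (V : Set (Euc N)) : ℝ≥0∞ :=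
  sSup {R : ℝ≥0∞ | EMetric.closedBall x R ⊆ V}

/-- The outer radius of a set `V` around `x`. -/
def rOut {N : ℕ} (x : Euc N) (V : Set (Euc N)) : ℝ≥0∞ :=
  sInf {R : ℝ≥0∞ | V ⊆ EMetric.closedBall x R}

/-- The distortion `λ(V) = r_out(V)/r_in(V)` of a set `V` around `x`. -/
def distortion {N : ℕ} (x : Euc N) (V : Set (Euc N)) : ℝ≥0∞ := rOut x V / rIn x V

/-- The distortion of a discrete set: the supremum of the distortions of its
Voronoi cells. -/
def setDistortion {N : ℕ} (Γ : Set (Euc N)) : ℝ≥0∞ :=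
  ⨆ x ∈ Γ, distortion x (voronoiCell Γ x)

/-- Uniformity of return words (U): the distortions of all locater sets of Λ are
uniformly bounded. -/
def URW {N : ℕ} (Λ : Set (Euc N)) : Prop :=
  (⨆ (x ∈ Λ) (R : ℝ) (_ : 0 < R), setDistortion (locSet Λ x R)) < ⊤

end

section Patterns

variable {N : ℕ} {Λ : Set (Euc N)}

theorem mem_locSet_iff {x y : Euc N} {R : ℝ} :
    y ∈ locSet Λ x R ↔ y ∈ Λ ∧ ∀ u : Euc N, ‖u‖ ≤ R → (y + u ∈ Λ ↔ x + u ∈ Λ) := by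
  have mem_patch (z u : Euc N) : u ∈ patch Λ z R ↔ z + u ∈ Λ ∧ ‖u‖ ≤ R := by
    simp only [patch, Set.mem_inter_iff, Set.mem_image, mem_closedBall_zero_iff]
    refine and_congr_left fun _ => ⟨?_, fun h => ⟨z + u, h, by simp⟩⟩
    rintro ⟨w, hw, rfl⟩
    simpa using hw
  simp only [locSet, Set.mem_ofPred_eq, Set.ext_iff, mem_patch]
  exact and_congr_right fun _ => forall_congr' fun u => and_congr_left_iff

theorem self_mem_locSet {x : Euc N} (hx : x ∈ Λ) (R : ℝ) : x ∈ locSet Λ x R := ⟨hx, rfl⟩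

theorem locSet_anti (x : Euc N) {r R : ℝ} (h : r ≤ R) : locSet Λ x R ⊆ locSet Λ x r := by
  intro y hy
  rw [mem_locSet_iff] at hy ⊢
  exact ⟨hy.1, fun u hu => hy.2 u (hu.trans h)⟩

theorem locSet_eq_of_mem {x y : Euc N} {R : ℝ} (hy : y ∈ locSet Λ x R) :
    locSet Λ y R = locSet Λ x R := by
  simp only [locSet, hy.2]

/-- A copy of `(x, r)` close to a copy `z` of `(y, R)` yields a copy of `(x, r)` at the same
relative position to `y`. -/
theorem add_sub_mem_locSet {x y z z' : Euc N} {r R : ℝ} (hr : 0 ≤ r) (hz : z ∈ locSet Λ y R)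
    (hz' : z' ∈ locSet Λ x r) (h : dist z z' + r ≤ R) : y + (z' - z) ∈ locSet Λ x r := by
  rw [mem_locSet_iff] at hz hz' ⊢
  rw [dist_comm, dist_eq_norm] at h
  refine ⟨?_, fun u hu => ?_⟩
  · rw [← hz.2 _ (by linarith)]
    simpa using hz'.1
  · rw [← hz'.2 u hu, add_assoc, ← hz.2 _ ((norm_add_le _ _).trans (by linarith))]
    congr! 1
    abel

theorem exists_dist_lower_bound (h : UniformlyDiscrete Λ) :
    ∃ δ > 0, ∀ x ∈ Λ, ∀ y ∈ Λ, x ≠ y → δ ≤ dist x y := by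
  obtain ⟨δ, hδ, hlt⟩ := ENNReal.lt_iff_exists_nnreal_btwn.1 (show 0 < rPack Λ from h)
  refine ⟨δ, by exact_mod_cast hδ, fun x hx y hy hxy => ?_⟩
  have h1 : (δ : ℝ≥0∞) ≤ edist x y / 2 :=
    hlt.le.trans (iInf₂_le_of_le x hx (iInf₂_le_of_le y hy (iInf_le _ hxy)))
  have h2 : (δ : ℝ≥0∞) ≤ edist x y := h1.trans ENNReal.half_le_self
  rw [edist_nndist, ENNReal.coe_le_coe] at h2
  exact_mod_cast h2

theorem RelativelyDense.nonempty (h : RelativelyDense Λ) : Λ.Nonempty := by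
  by_contra! h0
  subst h0
  have h0 : Metric.infEDist (0 : Euc N) ∅ ≤ rCov (∅ : Set (Euc N)) :=
    le_iSup (fun p => Metric.infEDist p (∅ : Set (Euc N))) 0
  rw [Metric.infEDist_empty, top_le_iff] at h0
  exact h.ne h0

theorem LR.exists_dist_le (h : LR Λ) : ∃ K : ℝ, 1 ≤ K ∧
    ∀ x ∈ Λ, ∀ R : ℝ, 1 ≤ R → ∀ p : Euc N, ∃ y ∈ locSet Λ x R, dist p y ≤ K * R := by
  set c := ⨆ (x ∈ Λ) (R : ℝ) (_ : 1 ≤ R), rCov (locSet Λ x R) / ENNReal.ofReal R with hc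
  refine ⟨c.toReal + 1, le_add_of_nonneg_left ENNReal.toReal_nonneg, fun x hx R hR p => ?_⟩
  have hR0 : 0 < R := by linarith
  have h1 : rCov (locSet Λ x R) / ENNReal.ofReal R ≤ c := by
    rw [hc]
    exact le_iSup₂_of_le x hx (le_iSup₂_of_le R hR le_rfl)
  have h2 : rCov (locSet Λ x R) ≤ c * ENNReal.ofReal R :=
    (ENNReal.div_le_iff (by simpa using hR0) (by simp)).1 h1
  have h3 : Metric.infEDist p (locSet Λ x R) < ENNReal.ofReal ((c.toReal + 1) * R) := by
    refine ((le_iSup (fun p => Metric.infEDist p (locSet Λ x R)) p).trans h2).trans_lt ?_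
    calc c * ENNReal.ofReal R = ENNReal.ofReal (c.toReal * R) := by
          rw [ENNReal.ofReal_mul ENNReal.toReal_nonneg,
            ENNReal.ofReal_toReal (show c ≠ ⊤ from h.ne)]
      _ < _ := (ENNReal.ofReal_lt_ofReal_iff (by positivity)).2 (by linarith)
  obtain ⟨y, hy, hpy⟩ := Metric.infEDist_lt_iff.1 h3
  refine ⟨y, hy, ?_⟩
  rw [edist_dist] at hpy
  exact (ENNReal.ofReal_lt_ofReal_iff_of_nonneg dist_nonneg).1 hpy |>.le

theorem LR.exists_repulsion (hΛ : UniformlyDiscrete Λ) (hnp : NonPeriodic Λ) (h : LR Λ) :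
    ∃ c > 0, ∀ x ∈ Λ, ∀ R : ℝ, 1 ≤ R → ∀ y ∈ locSet Λ x R, ∀ z ∈ locSet Λ x R, y ≠ z →
      c * R ≤ dist y z := by
  obtain ⟨δ, hδ, hsep⟩ := exists_dist_lower_bound hΛ
  obtain ⟨K, hK, hcov⟩ := h.exists_dist_le
  refine ⟨min (δ / (K + 2)) (1 / (2 * (K + 2))), by positivity, fun x hx R hR y hy z hz hyz => ?_⟩
  rcases le_total R (K + 2) with hRK | hRK
  · calc _ ≤ δ / (K + 2) * R := by gcongr; exact min_le_left _ _
      _ ≤ δ / (K + 2) * (K + 2) := by gcongr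
      _ = δ := by field_simp
      _ ≤ _ := hsep y hy.1 z hz.1 hyz
  refine le_trans (b := 1 / (2 * (K + 2)) * R) (by gcongr; exact min_le_right _ _) ?_
  by_contra! hlt
  set r := R / (K + 2) with hr
  have hr1 : 1 ≤ r := by rw [hr, le_div_iff₀ (by positivity)]; linarith
  have hKr : (K + 2) * r = R := by rw [hr]; field_simp
  set t := z - y with ht
  have ht2 : 2 * ‖t‖ ≤ r := by
    rw [ht, ← dist_eq_norm, dist_comm]
    have : 1 / (2 * (K + 2)) * R = r / 2 := by rw [hr]; field_simp
    linarith
  have hper : ∀ w ∈ Λ, ∀ u : Euc N, ‖u‖ ≤ r - ‖t‖ → (w + u ∈ Λ ↔ w + (u + t) ∈ Λ) := by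
    intro w hw u hu
    obtain ⟨w', hw', hd⟩ := hcov w hw r hr1 y
    rw [mem_locSet_iff] at hw' hy hz
    rw [dist_comm, dist_eq_norm] at hd
    have hn := norm_nonneg t
    have hs : ‖w' - y + u‖ ≤ R := (norm_add_le _ _).trans (by nlinarith)
    rw [← hw'.2 u (by linarith), ← hw'.2 (u + t) ((norm_add_le _ _).trans (by linarith))]
    have e := (hy.2 _ hs).trans (hz.2 _ hs).symm
    convert e using 2
    · abel
    · rw [ht]; abel
  have hn := norm_nonneg t
  refine hnp t (sub_ne_zero.2 hyz.symm) (Set.Subset.antisymm ?_ fun w hw => ⟨w + t, ?_, by simp⟩)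
  · rintro _ ⟨w, hw, rfl⟩
    have := hper w hw (-t) (by rw [norm_neg]; linarith)
    simpa [← sub_eq_add_neg, hw] using this
  · have := hper w hw 0 (by rw [norm_zero]; linarith)
    simpa [hw] using this

theorem LR.urw (hΛ : UniformlyDiscrete Λ) (hnp : NonPeriodic Λ) (h : LR Λ) : URW Λ := by
  obtain ⟨δ, hδ, hsep⟩ := exists_dist_lower_bound hΛ
  obtain ⟨K, hK, hcov⟩ := h.exists_dist_le
  obtain ⟨c, hc, hrep⟩ := h.exists_repulsion hΛ hnp
  set b := min c δ with hb
  have hb0 : 0 < b := lt_min hc hδ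
  refine lt_of_le_of_lt (b := ENNReal.ofReal (2 * K / b)) ?_ ENNReal.ofReal_lt_top
  refine iSup₂_le fun x hx => iSup₂_le fun R hR => iSup₂_le fun y hy => ?_
  set M := max 1 R with hM
  have hM1 : 1 ≤ M := le_max_left _ _
  have hin : ENNReal.ofReal (b * M / 2) ≤ rIn y (voronoiCell (locSet Λ x R) y) := by
    refine le_sSup fun p hp z hz => ?_
    rcases eq_or_ne y z with rfl | hyz
    · exact le_rfl
    have hp' : dist p y ≤ b * M / 2 := by
      change edist p y ≤ _ at hp
      rw [edist_dist] at hp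
      exact (ENNReal.ofReal_le_ofReal_iff (by positivity)).1 hp
    have hyz' : b * M ≤ dist y z := by
      rcases le_total 1 R with h1 | h1
      · rw [hM, max_eq_right h1]
        exact (mul_le_mul_of_nonneg_right (min_le_left _ _) hR.le).trans
          (hrep x hx R h1 y hy z hz hyz)
      · rw [hM, max_eq_left h1, mul_one]
        exact (min_le_right _ _).trans (hsep y hy.1 z hz.1 hyz)
    have := dist_triangle_left y z p
    linarith
  have hout : rOut y (voronoiCell (locSet Λ x R) y) ≤ ENNReal.ofReal (K * M) := by
    refine sInf_le fun p hp => ?_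
    obtain ⟨z, hz, hpz⟩ := hcov x hx M hM1 p
    change edist p y ≤ _
    rw [edist_dist]
    exact ENNReal.ofReal_le_ofReal ((hp z (locSet_anti x (le_max_right _ _) hz)).trans hpz)
  calc distortion y (voronoiCell (locSet Λ x R) y)
      ≤ ENNReal.ofReal (K * M) / ENNReal.ofReal (b * M / 2) := ENNReal.div_le_div hout hin
    _ = ENNReal.ofReal (2 * K / b) := by
      rw [← ENNReal.ofReal_div_of_pos (by positivity)]
      congr 1
      field_simp

theorem sum_volume_le_of_subset_cube {ι : Type*} (s : Finset ι) (S : ι → Set (Euc N))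
    (hm : ∀ i ∈ s, MeasurableSet (S i)) (hd : (s : Set ι).PairwiseDisjoint S) {a : Euc N} {l : ℝ}
    (hl : 0 ≤ l) (hsub : ∀ i ∈ s, S i ⊆ cube a l) : ∑ i ∈ s, volume.real (S i) ≤ l ^ N := by
  have hcube : volume (cube a l) = ENNReal.ofReal (l ^ N) := by
    have e : cube a l = WithLp.ofLp ⁻¹' Set.Icc (fun i => a i) (fun i => a i + l) := by
      ext p
      simp [cube, Pi.le_def, forall_and]
    rw [e, (PiLp.volume_preserving_ofLp (Fin N)).measure_preimage
      measurableSet_Icc.nullMeasurableSet, Real.volume_Icc_pi]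
    simp [ENNReal.ofReal_pow hl]
  have hfin : ∀ i ∈ s, volume (S i) ≠ ⊤ := fun i hi =>
    ((measure_mono (hsub i hi)).trans_lt (by simp [hcube])).ne
  have h := measure_mono (μ := volume) (Set.iUnion₂_subset hsub)
  rw [measure_biUnion_finset hd hm, hcube] at h
  have h' := ENNReal.toReal_mono ENNReal.ofReal_ne_top h
  rwa [ENNReal.toReal_sum hfin, ENNReal.toReal_ofReal (by positivity)] at h'

theorem volume_real_closedBall (x : Euc N) {r : ℝ} (hr : 0 ≤ r) :
    volume.real (Metric.closedBall x r) = r ^ N * ballVol N 1 := by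
  rw [measureReal_def, Measure.addHaar_closedBall' volume x hr, ENNReal.toReal_mul,
    ENNReal.toReal_ofReal (by positivity), ballVol]
  simp

theorem ballVol_eq {r : ℝ} (hr : 0 ≤ r) : ballVol N r = r ^ N * ballVol N 1 :=
  volume_real_closedBall 0 hr

theorem ballVol_one_pos : 0 < ballVol N 1 :=
  ENNReal.toReal_pos (Metric.measure_closedBall_pos volume _ one_pos).ne'
    measure_closedBall_lt_top.ne

theorem ballVol_nonneg (R : ℝ) : 0 ≤ ballVol N R := ENNReal.toReal_nonneg

theorem exists_card_le (hΛ : UniformlyDiscrete Λ) (x : Euc N) {R : ℝ} (hR : 0 < R) :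
    ∃ M : ℝ, ∀ (a : Euc N) (l : ℝ), 0 ≤ l → ∀ A : Finset (Euc N),
      ↑A ⊆ locIn Λ x R (cube a l) → (A.card : ℝ) ≤ M * l ^ N := by
  obtain ⟨δ, hδ, hsep⟩ := exists_dist_lower_bound hΛ
  set r := min R (δ / 3) with hr
  have hr0 : 0 < r := lt_min hR (by positivity)
  have hv : 0 < r ^ N * ballVol N 1 := mul_pos (by positivity) ballVol_one_pos
  refine ⟨(r ^ N * ballVol N 1)⁻¹, fun a l hl A hA => ?_⟩
  have h := sum_volume_le_of_subset_cube A (fun z => Metric.closedBall z r)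
    (fun _ _ => Metric.isClosed_closedBall.measurableSet) (fun y hy z hz hyz => ?_) hl
    (fun z hz => (Metric.closedBall_subset_closedBall (min_le_left _ _)).trans (hA hz).2)
  · simp only [volume_real_closedBall _ hr0.le, Finset.sum_const, nsmul_eq_mul] at h
    rwa [inv_mul_eq_div, le_div_iff₀ hv]
  · refine Metric.closedBall_disjoint_closedBall ?_
    have h1 := hsep y (hA hy).1.1 z (hA hz).1.1 hyz
    have h2 : r ≤ δ / 3 := min_le_right _ _
    linarith

theorem finite_locIn_cube (hΛ : UniformlyDiscrete Λ) (x : Euc N) {R : ℝ} (hR : 0 < R)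
    (a : Euc N) {l : ℝ} (hl : 0 ≤ l) : (locIn Λ x R (cube a l)).Finite := by
  obtain ⟨M, hM⟩ := exists_card_le hΛ x hR
  obtain ⟨n, hn⟩ := exists_nat_gt (M * l ^ N)
  by_contra hinf
  obtain ⟨A, hA, hcard⟩ := Set.Infinite.exists_subset_card_eq hinf n
  have := hM a l hl A hA
  rw [hcard] at this
  linarith

theorem card_le_countP (hΛ : UniformlyDiscrete Λ) (x : Euc N) {R : ℝ} (hR : 0 < R)
    (a : Euc N) {l : ℝ} (hl : 0 ≤ l) {A : Finset (Euc N)} (hA : ↑A ⊆ locIn Λ x R (cube a l)) :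
    A.card ≤ countP Λ x R (cube a l) := by
  rw [countP, ← Set.ncard_coe_finset]
  exact Set.ncard_le_ncard hA (finite_locIn_cube hΛ x hR a hl)

theorem countP'_le_countP (hΛ : UniformlyDiscrete Λ) (x : Euc N) {R : ℝ} (hR : 0 < R)
    (a : Euc N) {l : ℝ} (hl : 0 ≤ l) :
    countP' Λ x R (cube a l) ≤ countP Λ x R (cube a l) := by
  refine csSup_le' ?_
  rintro _ ⟨A, hA, -, rfl⟩
  exact card_le_countP hΛ x hR a hl hA

theorem card_le_countP' (hΛ : UniformlyDiscrete Λ) (x : Euc N) {R : ℝ} (hR : 0 < R)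
    (a : Euc N) {l : ℝ} (hl : 0 ≤ l) {A : Finset (Euc N)} (hA : ↑A ⊆ locIn Λ x R (cube a l))
    (hsep : ∀ u ∈ A, ∀ v ∈ A, u ≠ v → 2 * R < dist u v) :
    A.card ≤ countP' Λ x R (cube a l) := by
  refine le_csSup ⟨countP Λ x R (cube a l), ?_⟩ ⟨A, hA, hsep, rfl⟩
  rintro _ ⟨B, hB, -, rfl⟩
  exact card_le_countP hΛ x hR a hl hB

theorem eventually_cubeFilter {p : Euc N × ℝ → Prop} (l₀ : ℝ)
    (h : ∀ (a : Euc N) (l : ℝ), l₀ ≤ l → p (a, l)) : ∀ᶠ cs in cubeFilter N, p cs :=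
  (tendsto_snd.eventually (eventually_ge_atTop l₀)).mono fun cs hcs => h cs.1 cs.2 hcs

instance cubeFilter_neBot : (cubeFilter N).NeBot := by
  unfold cubeFilter
  infer_instance

theorem isBoundedUnder_countP (hΛ : UniformlyDiscrete Λ) (x : Euc N) {R : ℝ} (hR : 0 < R) :
    (cubeFilter N).IsBoundedUnder (· ≤ ·) (fun cs : Euc N × ℝ =>
      (countP Λ x R (cube cs.1 cs.2) : ℝ) * ballVol N R / cs.2 ^ N) := by
  obtain ⟨M, hM⟩ := exists_card_le hΛ x hR
  refine ⟨M * ballVol N R, eventually_map.2 (eventually_cubeFilter 1 fun a l hl => ?_)⟩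
  have hl0 : 0 < l := by linarith
  have hfin := finite_locIn_cube hΛ x hR a hl0.le
  have := hM a l hl0.le hfin.toFinset (by simp)
  rw [← Set.ncard_eq_toFinset_card _ hfin] at this
  change (countP Λ x R (cube a l) : ℝ) * ballVol N R / l ^ N ≤ _
  rw [div_le_iff₀ (by positivity), mul_right_comm]
  exact mul_le_mul_of_nonneg_right this (ballVol_nonneg R)

theorem isBoundedUnder_ge_density (f : Euc N × ℝ → ℕ) (R : ℝ) :
    (cubeFilter N).IsBoundedUnder (· ≥ ·) (fun cs : Euc N × ℝ =>
      (f cs : ℝ) * ballVol N R / cs.2 ^ N) := by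
  refine ⟨0, eventually_map.2 (eventually_cubeFilter 0 fun a l hl => ?_)⟩
  exact div_nonneg (mul_nonneg (Nat.cast_nonneg _) (ballVol_nonneg R)) (pow_nonneg hl N)

theorem eventually_countP'_le (hΛ : UniformlyDiscrete Λ) (x : Euc N) {R : ℝ} (hR : 0 < R) :
    ∀ᶠ cs : Euc N × ℝ in cubeFilter N,
      (countP' Λ x R (cube cs.1 cs.2) : ℝ) * ballVol N R / cs.2 ^ N ≤
        (countP Λ x R (cube cs.1 cs.2) : ℝ) * ballVol N R / cs.2 ^ N := by
  refine eventually_cubeFilter 0 fun a l hl => ?_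
  refine div_le_div_of_nonneg_right (mul_le_mul_of_nonneg_right ?_ (ballVol_nonneg R))
    (pow_nonneg hl N)
  exact_mod_cast countP'_le_countP hΛ x hR a hl

theorem isCoboundedUnder_countP' (hΛ : UniformlyDiscrete Λ) (x : Euc N) {R : ℝ} (hR : 0 < R) :
    (cubeFilter N).IsCoboundedUnder (· ≥ ·) (fun cs : Euc N × ℝ =>
      (countP' Λ x R (cube cs.1 cs.2) : ℝ) * ballVol N R / cs.2 ^ N) :=
  ((isBoundedUnder_countP hΛ x hR).mono_le (eventually_countP'_le hΛ x hR)).isCoboundedUnder_ge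

theorem nu'_le_nu (hΛ : UniformlyDiscrete Λ) (x : Euc N) {R : ℝ} (hR : 0 < R) :
    nu' Λ x R ≤ nu Λ x R :=
  liminf_le_liminf (eventually_countP'_le hΛ x hR) (isBoundedUnder_ge_density _ R)
    (isBoundedUnder_countP hΛ x hR).isCoboundedUnder_ge

theorem nu'_nonneg (hΛ : UniformlyDiscrete Λ) (x : Euc N) {R : ℝ} (hR : 0 < R) :
    0 ≤ nu' Λ x R :=
  le_liminf_of_le (isCoboundedUnder_countP' hΛ x hR) <| eventually_cubeFilter 0 fun _ _ hl =>
    div_nonneg (mul_nonneg (Nat.cast_nonneg _) (ballVol_nonneg R)) (pow_nonneg hl N)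

theorem wPQ_le_nu' (hΛ : UniformlyDiscrete Λ) {x : Euc N} (hx : x ∈ Λ) {R : ℝ} (hR : 1 ≤ R) :
    wPQ Λ ≤ nu' Λ x R := by
  refine csInf_le ⟨0, ?_⟩ ⟨x, hx, R, hR, rfl⟩
  rintro _ ⟨y, -, r, hr, rfl⟩
  exact nu'_nonneg hΛ y (by linarith)

theorem wPW_le_nu (hΛ : UniformlyDiscrete Λ) {x : Euc N} (hx : x ∈ Λ) {R : ℝ} (hR : 1 ≤ R) :
    wPW Λ ≤ nu Λ x R := by
  refine csInf_le ⟨0, ?_⟩ ⟨x, hx, R, hR, rfl⟩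
  rintro _ ⟨y, -, r, hr, rfl⟩
  exact (nu'_nonneg hΛ y (by linarith)).trans (nu'_le_nu hΛ y (by linarith))

theorem PQ.pw (hΛ : IsDelone Λ) (h : PQ Λ) : PW Λ := by
  obtain ⟨x, hx⟩ := hΛ.2.nonempty
  refine lt_of_lt_of_le h (le_csInf ⟨_, x, hx, 1, le_rfl, rfl⟩ ?_)
  rintro _ ⟨y, hy, R, hR, rfl⟩
  exact (wPQ_le_nu' hΛ.1 hy hR).trans (nu'_le_nu hΛ.1 y (by linarith))

theorem abs_sub_apply_le_dist (p q : Euc N) (i : Fin N) : |p i - q i| ≤ dist p q := by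
  rw [dist_eq_norm]
  exact PiLp.norm_apply_le (p - q) i

/-- If every point is `K * R`-close to a copy of `(x, R)`, then a large cube contains many
disjoint copies, one for each cell of a grid of mesh `2 * (K + 3) * R`. -/
theorem pow_le_countP' (hΛ : UniformlyDiscrete Λ) {x : Euc N} {K R : ℝ} (hK : 1 ≤ K) (hR : 0 < R)
    (hcov : ∀ p : Euc N, ∃ y ∈ locSet Λ x R, dist p y ≤ K * R) (a : Euc N) {l : ℝ} {n : ℕ}
    (hn : n * (2 * (K + 3) * R) ≤ l) : n ^ N ≤ countP' Λ x R (cube a l) := by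
  classical
  choose y hy hpy using hcov
  set e := 2 * (K + 3) * R with he
  have he0 : 0 < e := by positivity
  have hKR : 0 < K * R := by positivity
  have he' : e = 2 * (K * R) + 6 * R := by rw [he]; ring
  let c : (Fin N → Fin n) → Euc N := fun j => WithLp.toLp 2 fun i => a i + ((j i : ℝ) + 1 / 2) * e
  have hc (j : Fin N → Fin n) (i : Fin N) : |a i + ((j i : ℝ) + 1 / 2) * e - y (c j) i| ≤ K * R :=
    (abs_sub_apply_le_dist (c j) (y (c j)) i).trans (hpy _)
  have hfar : ∀ j j' : Fin N → Fin n, j ≠ j' → 2 * R < dist (y (c j)) (y (c j')) := by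
    intro j j' hjj
    obtain ⟨i, hi⟩ := Function.ne_iff.1 hjj
    wlog hlt : j i < j' i generalizing j j'
    · rw [dist_comm]
      exact this j' j hjj.symm hi.symm (lt_of_le_of_ne (not_lt.1 hlt) hi.symm)
    have h1 := abs_le.1 (hc j i)
    have h2 := abs_le.1 (hc j' i)
    have h3 := (neg_abs_le _).trans' (neg_le_neg (abs_sub_apply_le_dist (y (c j)) (y (c j')) i))
    have h4 : ((j i : ℕ) : ℝ) + 1 ≤ (j' i : ℕ) := by exact_mod_cast hlt
    have h5 := mul_le_mul_of_nonneg_right h4 he0.le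
    nlinarith
  have hinj : Function.Injective fun j => y (c j) := by
    intro j j' hjj
    by_contra hne
    have := hfar j j' hne
    simp only [hjj, dist_self] at this
    linarith
  have hcard : (Finset.univ.image fun j => y (c j)).card = n ^ N := by
    rw [Finset.card_image_of_injective _ hinj]
    simp
  rw [← hcard]
  refine card_le_countP' hΛ x hR a (le_trans (by positivity) hn) ?_ ?_
  · intro z hz
    obtain ⟨j, -, rfl⟩ := Finset.mem_image.1 (Finset.mem_coe.1 hz)
    refine ⟨hy _, fun q hq i => ?_⟩
    have h1 := abs_le.1 (hc j i)
    have h2 := abs_le.1 ((abs_sub_apply_le_dist q (y (c j)) i).trans hq)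
    have h3 : ((j i : ℕ) : ℝ) + 1 ≤ n := by exact_mod_cast (j i).2
    have h4 := mul_le_mul_of_nonneg_right h3 he0.le
    have h5 : 0 ≤ ((j i : ℕ) : ℝ) * e := by positivity
    constructor <;> nlinarith
  · intro u hu v hv huv
    obtain ⟨j, -, rfl⟩ := Finset.mem_image.1 hu
    obtain ⟨j', -, rfl⟩ := Finset.mem_image.1 hv
    exact hfar j j' fun h => huv (by rw [h])

theorem LR.pq (hΛ : IsDelone Λ) (h : LR Λ) : PQ Λ := by
  obtain ⟨K, hK, hcov⟩ := h.exists_dist_le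
  obtain ⟨x₀, hx₀⟩ := hΛ.2.nonempty
  have hv := ballVol_one_pos (N := N)
  refine lt_of_lt_of_le (b := ballVol N 1 / (4 * (K + 3)) ^ N) (by positivity)
    (le_csInf ⟨_, x₀, hx₀, 1, le_rfl, rfl⟩ ?_)
  rintro _ ⟨x, hx, R, hR, rfl⟩
  have hR0 : 0 < R := by linarith
  have he : 0 < 2 * (K + 3) * R := by positivity
  refine le_liminf_of_le (isCoboundedUnder_countP' hΛ.1 x hR0) <|
    eventually_cubeFilter (2 * (K + 3) * R) fun a l hl => ?_
  have hl0 : 0 < l := he.trans_le hl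
  have hq : 1 ≤ l / (2 * (K + 3) * R) := (one_le_div he).2 hl
  set n := ⌊l / (2 * (K + 3) * R)⌋₊ with hn
  have hn1 : (1 : ℝ) ≤ n := by exact_mod_cast (Nat.one_le_floor_iff _).2 hq
  have hn2 := Nat.lt_floor_add_one (l / (2 * (K + 3) * R))
  rw [← hn] at hn2
  have hn3 : l / (4 * (K + 3) * R) ≤ n := by
    have : l / (4 * (K + 3) * R) = l / (2 * (K + 3) * R) / 2 := by field_simp; norm_num
    linarith
  have hcount : ((n : ℝ) ^ N) ≤ countP' Λ x R (cube a l) := by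
    exact_mod_cast pow_le_countP' hΛ.1 hK hR0 (hcov x hx R hR) a
      ((le_div_iff₀ he).1 (Nat.floor_le (by positivity)))
  calc ballVol N 1 / (4 * (K + 3)) ^ N
      = (l / (4 * (K + 3) * R)) ^ N * ballVol N R / l ^ N := by
        rw [ballVol_eq hR0.le, div_pow, mul_pow _ R]
        field_simp
    _ ≤ countP' Λ x R (cube a l) * ballVol N R / l ^ N := by
        have := ballVol_nonneg (N := N) R
        gcongr
        exact (pow_le_pow_left₀ (by positivity) hn3 N).trans hcount

/-- Under (PW), copies of a pattern `P` cannot be isolated at a scale much larger than `P`: an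
isolated copy would give, at every dyadic scale, a positive proportion of space covered by shells
around copies isolated at that scale, and these shells are disjoint. -/
theorem PW.exists_near_copy (hN : 0 < N) (hΛ : UniformlyDiscrete Λ) (h : PW Λ) :
    ∃ m : ℕ, ∀ x ∈ Λ, ∀ R : ℝ, 1 ≤ R → ∀ y ∈ locSet Λ x R,
      ∃ z ∈ locSet Λ x R, z ≠ y ∧ dist y z ≤ 2 ^ m * R := by
  have hw : 0 < wPW Λ := h
  set w := wPW Λ
  obtain ⟨m, hm⟩ := exists_nat_gt (4 * 4 ^ N / w)
  refine ⟨m, fun x hx R hR y hy => ?_⟩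
  by_contra! hiso
  have hR0 : 0 < R := by linarith
  have hv := ballVol_one_pos (N := N)
  set ρ : ℕ → ℝ := fun k => 2 ^ (k + 1) * R with hρ
  have hρ0 (k : ℕ) : 0 < ρ k := by positivity
  have hρR (k : ℕ) : 2 * R ≤ ρ k := by
    have : (1 : ℝ) ≤ 2 ^ k := one_le_pow₀ one_le_two
    simp only [hρ, pow_succ]
    nlinarith
  have hρ_lt {k k' : ℕ} (hk : k < k') : 2 * ρ k ≤ ρ k' := by
    have : (2 : ℝ) ^ (k + 1) ≤ 2 ^ k' := pow_le_pow_right₀ one_le_two hk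
    simp only [hρ, pow_succ] at this ⊢
    nlinarith
  have hρ_mono : Monotone ρ := fun k k' hk => by
    rcases hk.eq_or_lt with rfl | hlt
    · exact le_rfl
    · linarith [hρ_lt hlt, hρ0 k]
  have hsub (k : ℕ) : locSet Λ y (ρ k) ⊆ locSet Λ x R := by
    rw [← locSet_eq_of_mem hy]
    exact locSet_anti y (by linarith [hρR k])
  have hfar {k : ℕ} (hk : k < m) {z z' : Euc N} (hz : z ∈ locSet Λ y (ρ k))
      (hz' : z' ∈ locSet Λ x R) (hne : z ≠ z') : ρ k / 2 < dist z z' := by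
    by_contra! hle
    have hmem := add_sub_mem_locSet hR0.le hz hz' (by linarith [hρR k])
    have := hiso _ hmem (by simpa [sub_eq_zero] using hne.symm)
    rw [dist_self_add_right, ← dist_eq_norm, dist_comm] at this
    have hkm : ρ k ≤ 2 ^ m * R :=
      mul_le_mul_of_nonneg_right (pow_le_pow_right₀ one_le_two hk) hR0.le
    linarith [hρ0 k]
  have hev : ∀ k ∈ Finset.range m, ∀ᶠ cs : Euc N × ℝ in cubeFilter N,
      w / 2 < (countP Λ y (ρ k) (cube cs.1 cs.2) : ℝ) * ballVol N (ρ k) / cs.2 ^ N := fun k _ =>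
    eventually_lt_of_lt_liminf
      (lt_of_lt_of_le (by linarith) (wPW_le_nu hΛ hy.1 (by linarith [hρR k])))
      (isBoundedUnder_ge_density _ _)
  obtain ⟨⟨a, l⟩, hcs, hl⟩ := (((Finset.range m).eventually_all.2 hev).and
    (eventually_cubeFilter (p := fun cs => 0 < cs.2) 1 fun _ l hl => by
      simpa using lt_of_lt_of_le one_pos hl)).exists
  simp only at hcs hl
  have hfin (k : ℕ) := finite_locIn_cube hΛ y (hρ0 k) a hl.le
  set F : Finset (Σ _ : ℕ, Euc N) := (Finset.range m).sigma fun k => (hfin k).toFinset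
  let S : (Σ _ : ℕ, Euc N) → Set (Euc N) := fun i =>
    Metric.closedBall i.2 (ρ i.1 / 4) \ Metric.closedBall i.2 (ρ i.1 / 8)
  have hF {i : Σ _ : ℕ, Euc N} (hi : i ∈ F) :
      i.1 < m ∧ i.2 ∈ locIn Λ y (ρ i.1) (cube a l) := by
    simpa [F] using hi
  have hdisj : (F : Set (Σ _ : ℕ, Euc N)).PairwiseDisjoint S := by
    have key : ∀ i ∈ F, ∀ j ∈ F, i ≠ j → i.1 ≤ j.1 → Disjoint (S i) (S j) := by
      rintro ⟨k, z⟩ hi ⟨k', z'⟩ hj hij (hkk : k ≤ k')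
      obtain ⟨-, hz⟩ := hF hi
      obtain ⟨hk', hz'⟩ := hF hj
      simp only at hz hk' hz'
      rcases eq_or_ne z z' with rfl | hne
      · have hlt : k < k' := lt_of_le_of_ne hkk fun h => hij (by rw [h])
        refine Set.disjoint_left.2 fun p hp hp' => hp'.2 ?_
        exact Metric.closedBall_subset_closedBall (by linarith [hρ_lt hlt]) hp.1
      · refine (Metric.closedBall_disjoint_closedBall ?_).mono Set.sdiff_subset Set.sdiff_subset
        have := hfar hk' hz'.1 (hsub k hz.1) hne.symm
        rw [dist_comm] at this
        simp only
        linarith [hρ_mono hkk]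
    intro i hi j hj hij
    rcases le_total i.1 j.1 with hle | hle
    · exact key i hi j hj hij hle
    · exact (key j hj i hi hij.symm hle).symm
  have hSsub : ∀ i ∈ F, S i ⊆ cube a l := fun i hi =>
    (Set.sdiff_subset.trans (Metric.closedBall_subset_closedBall (by linarith [hρ0 i.1]))).trans
      (hF hi).2.2
  have hsum := sum_volume_le_of_subset_cube F S
    (fun _ _ => Metric.isClosed_closedBall.measurableSet.diff
      Metric.isClosed_closedBall.measurableSet) hdisj hl.le hSsub
  have hSvol (i : Σ _ : ℕ, Euc N) : ballVol N (ρ i.1) / (2 * 4 ^ N) ≤ volume.real (S i) := by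
    have h0 := hρ0 i.1
    rw [measureReal_sdiff (Metric.closedBall_subset_closedBall (by linarith))
      Metric.isClosed_closedBall.measurableSet measure_closedBall_lt_top.ne,
      volume_real_closedBall _ (by positivity),
      volume_real_closedBall _ (by positivity), ballVol_eq h0.le]
    have h8 : (ρ i.1 / 8) ^ N ≤ (ρ i.1 / 4) ^ N / 2 := by
      have : ρ i.1 / 8 = ρ i.1 / 4 * (1 / 2) := by ring
      rw [this, mul_pow, div_eq_mul_one_div ((ρ i.1 / 4) ^ N) (2 : ℝ)]
      gcongr
      exact pow_le_of_le_one (by norm_num) (by norm_num) hN.ne'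
    calc ρ i.1 ^ N * ballVol N 1 / (2 * 4 ^ N) = (ρ i.1 / 4) ^ N / 2 * ballVol N 1 := by
          rw [div_pow]; field_simp
      _ ≤ _ := by nlinarith
  have hlow : ∀ k ∈ Finset.range m,
      w / (4 * 4 ^ N) * l ^ N ≤ ∑ z ∈ (hfin k).toFinset, volume.real (S ⟨k, z⟩) := by
    intro k hk
    have h1 := hcs k hk
    rw [lt_div_iff₀ (by positivity)] at h1
    calc w / (4 * 4 ^ N) * l ^ N = w / 2 * l ^ N / (2 * 4 ^ N) := by field_simp; norm_num
      _ ≤ countP Λ y (ρ k) (cube a l) * ballVol N (ρ k) / (2 * 4 ^ N) := by gcongr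
      _ = ∑ z ∈ (hfin k).toFinset, ballVol N (ρ k) / (2 * 4 ^ N) := by
        rw [Finset.sum_const, nsmul_eq_mul, countP, Set.ncard_eq_toFinset_card _ (hfin k)]
        ring
      _ ≤ _ := Finset.sum_le_sum fun z _ => hSvol ⟨k, z⟩
  rw [Finset.sum_sigma] at hsum
  have htot := (Finset.sum_le_sum hlow).trans hsum
  rw [Finset.sum_const, Finset.card_range, nsmul_eq_mul, ← mul_assoc] at htot
  have hlN : 0 < l ^ N := by positivity
  have hone : m * (w / (4 * 4 ^ N)) ≤ 1 := by
    by_contra! hgt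
    nlinarith
  rw [div_lt_iff₀ hw] at hm
  rw [← mul_div_assoc, div_le_one (by positivity)] at hone
  linarith

theorem PW.lr (hN : 0 < N) (hΛ : UniformlyDiscrete Λ) (h : PW Λ) (hU : URW Λ) : LR Λ := by
  obtain ⟨δ, hδ, hsep⟩ := exists_dist_lower_bound hΛ
  obtain ⟨m, hm⟩ := h.exists_near_copy hN hΛ
  set d := ⨆ (x ∈ Λ) (R : ℝ) (_ : 0 < R), setDistortion (locSet Λ x R) with hd
  have hdtop : d ≠ ⊤ := hU.ne
  refine lt_of_le_of_lt (b := d * ENNReal.ofReal (2 ^ m)) ?_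
    (ENNReal.mul_lt_top hU ENNReal.ofReal_lt_top)
  refine iSup₂_le fun x hx => iSup₂_le fun R hR => ENNReal.div_le_of_le_mul ?_
  have hR0 : 0 < R := by linarith
  rw [mul_assoc, ← ENNReal.ofReal_mul (by positivity)]
  refine iSup_le fun p => ?_
  have hclosed : IsClosed (locSet Λ x R) :=
    Metric.isClosed_of_pairwise_le_dist hδ fun y hy z hz hyz => hsep y hy.1 z hz.1 hyz
  obtain ⟨y, hy, hpy⟩ := hclosed.exists_infDist_eq_dist ⟨x, self_mem_locSet hx R⟩ p
  have hp : p ∈ voronoiCell (locSet Λ x R) y := fun z hz =>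
    hpy ▸ Metric.infDist_le_dist_of_mem hz
  obtain ⟨z, hz, hzy, hyz⟩ := hm x hx R hR y hy
  have hin : rIn y (voronoiCell (locSet Λ x R) y) ≤ ENNReal.ofReal (2 ^ m * R) := by
    refine sSup_le fun r hr => ?_
    by_contra! hlt
    have hmem : z ∈ voronoiCell (locSet Λ x R) y := hr <| by
      change edist z y ≤ r
      rw [edist_dist, dist_comm]
      exact (ENNReal.ofReal_le_ofReal hyz).trans hlt.le
    have := hmem z hz
    rw [dist_self] at this
    exact hzy (dist_le_zero.1 this)
  have hdist : distortion y (voronoiCell (locSet Λ x R) y) ≤ d := by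
    rw [hd]
    exact le_iSup₂_of_le x hx (le_iSup₂_of_le R hR0
      (le_iSup₂ (f := fun y _ => distortion y (voronoiCell (locSet Λ x R) y)) y hy))
  have hout : rOut y (voronoiCell (locSet Λ x R) y) ≤ d * ENNReal.ofReal (2 ^ m * R) :=
    ((ENNReal.div_le_iff_le_mul (Or.inr hdtop)
      (Or.inl (hin.trans_lt ENNReal.ofReal_lt_top).ne)).1 hdist).trans (by gcongr)
  refine (Metric.infEDist_le_edist_of_mem hy).trans ((le_sInf fun r hr => ?_).trans hout)
  have hsub : voronoiCell (locSet Λ x R) y ⊆ Metric.closedEBall y r := hr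
  exact hsub hp

end Patterns

/-- For a non-periodic Delone set the following are equivalent:
(i) (LR); (ii) (PQ) and (U); (iii) (PW) and (U). -/
theorem lr_iff_pq_u_iff_pw_u {N : ℕ} (hN : 0 < N) (Λ : Set (Euc N))
    (hΛ : IsDelone Λ) (hnp : NonPeriodic Λ) :
    (LR Λ ↔ PQ Λ ∧ URW Λ) ∧ ((PQ Λ ∧ URW Λ) ↔ PW Λ ∧ URW Λ) := by
  have hpw : PW Λ ∧ URW Λ → LR Λ := fun h => h.1.lr hN hΛ.1 h.2
  have hpq : LR Λ → PQ Λ ∧ URW Λ := fun h => ⟨h.pq hΛ, h.urw hΛ.1 hnp⟩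
  exact ⟨⟨hpq, fun h => hpw ⟨h.1.pw hΛ, h.2⟩⟩, fun h => ⟨h.1.pw hΛ, h.2⟩, fun h => hpq (hpw h)⟩
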